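/- Multi-source domain adaptation bound in latent space (λ* form). For every hypothesis h ∈ H, the target error satisfies ε_t(h) ≤ Σ_{k=1}^K α_k·ε_k(h) + (1/2)·d_{HΔH}(P_α, P_t) + λ*_{α,t}, where λ*_{α,t} = inf_{h' ∈ H} ( Σ_{k=1}^K α_k·ε_k(h') + ε_t(h') ). -/

import Mathlib

open MeasureTheory

/-- Probability (as a real number) that two hypotheses disagree under `P`. -/
noncomputable def disagreeProb {Z Y : Type*} [MeasurableSpace Z]
    (P : Measure Z) (g g' : Z → Y) : ℝ :=
  (P {z | g z ≠ g' z}).toReal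

/-- The `HΔH`-divergence between two measures `P` and `Q` with respect to a
hypothesis class `H`:
`d_{HΔH}(P, Q) = 2 · sup_{h,h' ∈ H} |P{h ≠ h'} − Q{h ≠ h'}|`. -/
noncomputable def dHDeltaH {Z Y : Type*} [MeasurableSpace Z]
    (H : Set (Z → Y)) (P Q : Measure Z) : ℝ :=
  2 * sSup {r : ℝ | ∃ h ∈ H, ∃ h' ∈ H, r = |disagreeProb P h h' - disagreeProb Q h h'|}

theorem disagreeProb_nonneg {Z Y : Type*} [MeasurableSpace Z] (P : Measure Z) (g g' : Z → Y) :
    0 ≤ disagreeProb P g g' :=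
  ENNReal.toReal_nonneg

theorem disagreeProb_le_one {Z Y : Type*} [MeasurableSpace Z] (P : Measure Z)
    [IsProbabilityMeasure P] (g g' : Z → Y) : disagreeProb P g g' ≤ 1 :=
  measureReal_le_one

theorem disagreeProb_comm {Z Y : Type*} [MeasurableSpace Z] (P : Measure Z) (g g' : Z → Y) :
    disagreeProb P g g' = disagreeProb P g' g := by
  simp only [disagreeProb, ne_comm]

theorem disagreeProb_triangle {Z Y : Type*} [MeasurableSpace Z] (P : Measure Z)
    [IsFiniteMeasure P] (a b c : Z → Y) :
    disagreeProb P a c ≤ disagreeProb P a b + disagreeProb P b c := by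
  have hsub : {z | a z ≠ c z} ⊆ {z | a z ≠ b z} ∪ {z | b z ≠ c z} := by
    intro z hz
    by_contra hn
    simp only [Set.mem_union, Set.mem_ofPred_eq, not_or, not_not] at hn
    exact hz (hn.1.trans hn.2)
  exact (measureReal_mono hsub).trans (measureReal_union_le _ _)

theorem disagreeProb_sum_smul {Z Y ι : Type*} [MeasurableSpace Z] [Fintype ι]
    (P : ι → Measure Z) [∀ k, IsFiniteMeasure (P k)] (α : ι → ℝ) (hα : ∀ k, 0 ≤ α k)
    (g g' : Z → Y) :
    disagreeProb (∑ k, ENNReal.ofReal (α k) • P k) g g' =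
      ∑ k, α k * disagreeProb (P k) g g' := by
  simp only [disagreeProb, Measure.finsetSum_apply, Measure.smul_apply, smul_eq_mul]
  rw [ENNReal.toReal_sum fun k _ => ENNReal.mul_ne_top ENNReal.ofReal_ne_top (measure_ne_top _ _)]
  simp only [ENNReal.toReal_mul, ENNReal.toReal_ofReal (hα _)]

theorem isProbabilityMeasure_sum_smul {Z ι : Type*} [MeasurableSpace Z] [Fintype ι]
    (P : ι → Measure Z) [∀ k, IsProbabilityMeasure (P k)] (α : ι → ℝ) (hα : ∀ k, 0 ≤ α k)
    (hsum : ∑ k, α k = 1) : IsProbabilityMeasure (∑ k, ENNReal.ofReal (α k) • P k) := by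
  constructor
  simp only [Measure.finsetSum_apply, Measure.smul_apply, smul_eq_mul, measure_univ, mul_one]
  rw [← ENNReal.ofReal_sum_of_nonneg fun k _ => hα k, hsum, ENNReal.ofReal_one]

theorem abs_disagreeProb_sub_le_dHDeltaH {Z Y : Type*} [MeasurableSpace Z] {H : Set (Z → Y)}
    (P Q : Measure Z) [IsProbabilityMeasure P] [IsProbabilityMeasure Q]
    {h h' : Z → Y} (hh : h ∈ H) (hh' : h' ∈ H) :
    |disagreeProb P h h' - disagreeProb Q h h'| ≤ (1 / 2) * dHDeltaH H P Q := by
  have hbdd : BddAbove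
      {r : ℝ | ∃ h ∈ H, ∃ h' ∈ H, r = |disagreeProb P h h' - disagreeProb Q h h'|} := by
    refine ⟨1, ?_⟩
    rintro _ ⟨g, -, g', -, rfl⟩
    rw [abs_le]
    constructor <;> linarith [disagreeProb_nonneg P g g', disagreeProb_le_one P g g',
      disagreeProb_nonneg Q g g', disagreeProb_le_one Q g g']
  have := le_csSup hbdd ⟨h, hh, h', hh', rfl⟩
  rw [dHDeltaH]
  linarith

/-- **Multi-source domain adaptation bound in latent space (λ* form).**
For source domains `(P k, f k)`, target domain `(Pt, ft)`, a nonempty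
hypothesis class `H`, convex weights `α`, and source mixture
`Pα = Σ_k α_k • P k`, every hypothesis `h ∈ H` satisfies
`ε_t(h) ≤ Σ_k α_k ε_k(h) + (1/2) d_{HΔH}(Pα, Pt) + λ*_{α,t}`, where
`λ*_{α,t} = inf_{h' ∈ H} (Σ_k α_k ε_k(h') + ε_t(h'))`. -/
theorem multi_source_domain_adaptation_bound
    {Z Y : Type*} [MeasurableSpace Z]
    (K : ℕ) (P : Fin K → Measure Z) [∀ k, IsProbabilityMeasure (P k)]
    (f : Fin K → Z → Y)
    (Pt : Measure Z) [IsProbabilityMeasure Pt] (ft : Z → Y)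
    (H : Set (Z → Y)) (hH : H.Nonempty)
    (hmeas : ∀ g ∈ H ∪ Set.range f ∪ {ft}, ∀ g' ∈ H ∪ Set.range f ∪ {ft},
      MeasurableSet {z | g z ≠ g' z})
    (α : Fin K → ℝ) (hα0 : ∀ k, 0 ≤ α k) (hα1 : ∑ k, α k = 1)
    (Pα : Measure Z) (hPα : Pα = ∑ k, ENNReal.ofReal (α k) • P k)
    (h : Z → Y) (hh : h ∈ H) :
    disagreeProb Pt h ft ≤
      (∑ k, α k * disagreeProb (P k) h (f k))
        + (1 / 2) * dHDeltaH H Pα Pt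
        + sInf {r : ℝ | ∃ h' ∈ H,
            r = (∑ k, α k * disagreeProb (P k) h' (f k)) + disagreeProb Pt h' ft} := by
  subst hPα
  have := isProbabilityMeasure_sum_smul P α hα0 hα1
  rw [← sub_le_iff_le_add']
  refine le_csInf ?_ ?_
  · obtain ⟨g, hg⟩ := hH
    exact ⟨_, g, hg, rfl⟩
  rintro _ ⟨g, hg, rfl⟩
  have hdiv := (abs_le.1 (abs_disagreeProb_sub_le_dHDeltaH
    (∑ k, ENNReal.ofReal (α k) • P k) Pt hh hg)).1
  have htri := disagreeProb_triangle Pt h g ft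
  have hsrc : disagreeProb (∑ k, ENNReal.ofReal (α k) • P k) h g ≤
      (∑ k, α k * disagreeProb (P k) h (f k)) + ∑ k, α k * disagreeProb (P k) g (f k) := by
    rw [disagreeProb_sum_smul P α hα0, ← Finset.sum_add_distrib]
    refine Finset.sum_le_sum fun k _ => ?_
    rw [← mul_add, disagreeProb_comm (P k) g]
    exact mul_le_mul_of_nonneg_left (disagreeProb_triangle _ _ _ _) (hα0 k)
  linarith
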